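/- arXiv:2011.03662 — 2 statements merged into one kernel-verified Lean document; each statement's English description precedes it below -/
import Mathlib

section
/- Let φ be a 3-form on ℝ⁶ with λ_φ < 0. Then for all x, y, z ∈ ℝ⁶: φ(J_φ x, y, z) = φ(x, J_φ y, z) = φ(x, y, J_φ z), and φ(J_φ x, J_φ y, z) = −φ(x, y, z). Consequently φ̂(x, y, z) = −φ(J_φ x, y, z) for all x, y, z, i.e. φ + i φ̂ is a (3,0)-form with respect to J_φ. -/
noncomputable section

/-- The underlying vector space `V = ℝ⁶`. -/
abbrev V6 : Type := Fin 6 → ℝ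

/-- The standard basis of `ℝ⁶`. -/
def e6 (i : Fin 6) : V6 := fun j => if j = i then (1 : ℝ) else 0

/-- The standard symplectic form `ω = e¹∧e² + e³∧e⁴ + e⁵∧e⁶`. -/
def ω6 (x y : V6) : ℝ :=
  x 0 * y 1 - x 1 * y 0 + x 2 * y 3 - x 3 * y 2 + x 4 * y 5 - x 5 * y 4

/-- Wedge product of a 2-form and a 3-form (standard convention `1/(2!·3!)`). -/
def wedge23 (a : V6 → V6 → ℝ) (b : V6 → V6 → V6 → ℝ) (v : Fin 5 → V6) : ℝ :=
  (1 / 12 : ℝ) * ∑ σ : Equiv.Perm (Fin 5),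
    ((Equiv.Perm.sign σ : ℤ) : ℝ) *
      (a (v (σ 0)) (v (σ 1)) * b (v (σ 2)) (v (σ 3)) (v (σ 4)))

/-- Hitchin's map `K_φ`, characterized by `ι_{K_φ v} vol = -(ι_v φ) ∧ φ` (here written out
in components using the volume form `vol = e¹∧⋯∧e⁶`). -/
def Kmap (φ : V6 → V6 → V6 → ℝ) (x : V6) : V6 := fun i =>
  (-1 : ℝ) ^ (i : ℕ) *
    (-(wedge23 (fun y z => φ x y z) φ (fun j => e6 (i.succAbove j))))

/-- Hitchin's invariant `λ_φ = (1/6)·tr(K_φ²)`. -/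
def lamH (φ : V6 → V6 → V6 → ℝ) : ℝ :=
  (1 / 6 : ℝ) * ∑ i : Fin 6, Kmap φ (Kmap φ (e6 i)) i

/-- Hitchin's almost complex structure `J_φ = K_φ / √(-λ_φ)`. -/
def Jmap (φ : V6 → V6 → V6 → ℝ) (x : V6) : V6 :=
  (Real.sqrt (-(lamH φ)))⁻¹ • Kmap φ x

/-- A 3-form, viewed as a trilinear function of vectors. -/
def ap3 (φ : AlternatingMap ℝ V6 ℝ (Fin 3)) : V6 → V6 → V6 → ℝ :=
  fun x y z => φ ![x, y, z]

/-- The alternating sum of `F` over all rearrangements of `v`. -/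
def signedSum {α : Type*} {n : ℕ} (v : Fin n → α) (F : (Fin n → α) → ℝ) : ℝ :=
  ∑ σ : Equiv.Perm (Fin n), ((Equiv.Perm.sign σ : ℤ) : ℝ) * F (v ∘ σ)

theorem signedSum_succ {α : Type*} {n : ℕ} (v : Fin (n + 1) → α) (F : (Fin (n + 1) → α) → ℝ) :
    signedSum v F = ∑ p, (if p = 0 then 1 else -1) *
      signedSum (fun k => v (Equiv.swap 0 p k.succ)) (fun w => F (Matrix.vecCons (v p) w)) := by
  unfold signedSum
  rw [Finset.univ_perm_fin_succ, Finset.sum_map, Finset.univ_product_univ.symm, Finset.sum_product]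
  refine Finset.sum_congr rfl fun p _ => ?_
  rw [Finset.mul_sum]
  refine Finset.sum_congr rfl fun τ _ => ?_
  have : v ∘ (Equiv.Perm.decomposeFin.symm (p, τ)) =
      Matrix.vecCons (v p) ((fun k => v (Equiv.swap 0 p k.succ)) ∘ τ) := by
    ext k
    refine Fin.cases ?_ (fun k => ?_) k <;> simp
  simp only [Equiv.coe_toEmbedding, this, Equiv.Perm.decomposeFin.symm_sign]
  split_ifs <;> simp

theorem signedSum_one {α : Type*} (a : α) (F : (Fin 1 → α) → ℝ) : signedSum ![a] F = F ![a] := by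
  simp [signedSum]

theorem signedSum_two {α : Type*} (a b : α) (F : (Fin 2 → α) → ℝ) :
    signedSum ![a, b] F = F ![a, b] - F ![b, a] := by
  have h (p : Fin 2) : (fun k : Fin 1 => ![a, b] (Equiv.swap 0 p k.succ)) = ![![b, a] p] := by
    ext k; fin_cases p <;> fin_cases k <;> rfl
  simp [signedSum_succ ![a, b], h, signedSum_one, Fin.sum_univ_succ, sub_eq_add_neg]

theorem signedSum_three {α : Type*} (a b c : α) (F : (Fin 3 → α) → ℝ) :
    signedSum ![a, b, c] F = F ![a, b, c] - F ![a, c, b] - F ![b, a, c] + F ![b, c, a] -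
      F ![c, b, a] + F ![c, a, b] := by
  have h (p : Fin 3) : (fun k : Fin 2 => ![a, b, c] (Equiv.swap 0 p k.succ)) =
      ![![b, a, b] p, ![c, c, a] p] := by
    ext k; fin_cases p <;> fin_cases k <;> rfl
  simp [signedSum_succ ![a, b, c], h, signedSum_two, Fin.sum_univ_succ]
  ring

theorem signedSum_four {α : Type*} (a b c d : α) (F : (Fin 4 → α) → ℝ) :
    signedSum ![a, b, c, d] F = signedSum ![b, c, d] (fun w => F (Matrix.vecCons a w)) -
      signedSum ![a, c, d] (fun w => F (Matrix.vecCons b w)) -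
      signedSum ![b, a, d] (fun w => F (Matrix.vecCons c w)) -
      signedSum ![b, c, a] (fun w => F (Matrix.vecCons d w)) := by
  have h (p : Fin 4) : (fun k : Fin 3 => ![a, b, c, d] (Equiv.swap 0 p k.succ)) =
      ![![b, a, b, b] p, ![c, c, a, c] p, ![d, d, d, a] p] := by
    ext k; fin_cases p <;> fin_cases k <;> rfl
  simp [signedSum_succ ![a, b, c, d], h, Fin.sum_univ_succ]
  ring

theorem signedSum_five {α : Type*} (a b c d e : α) (F : (Fin 5 → α) → ℝ) :
    signedSum ![a, b, c, d, e] F = signedSum ![b, c, d, e] (fun w => F (Matrix.vecCons a w)) -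
      signedSum ![a, c, d, e] (fun w => F (Matrix.vecCons b w)) -
      signedSum ![b, a, d, e] (fun w => F (Matrix.vecCons c w)) -
      signedSum ![b, c, a, e] (fun w => F (Matrix.vecCons d w)) -
      signedSum ![b, c, d, a] (fun w => F (Matrix.vecCons e w)) := by
  have h (p : Fin 5) : (fun k : Fin 4 => ![a, b, c, d, e] (Equiv.swap 0 p k.succ)) =
      ![![b, a, b, b, b] p, ![c, c, a, c, c] p, ![d, d, d, a, d] p, ![e, e, e, e, a] p] := by
    ext k; fin_cases p <;> fin_cases k <;> rfl
  simp [signedSum_succ ![a, b, c, d, e], h, Fin.sum_univ_succ]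
  ring

theorem wedge23_eq (g : V6 → V6 → ℝ) (f : V6 → V6 → V6 → ℝ)
    (hg : ∀ x y, g x y = -g y x)
    (h₁ : ∀ x y z, f x y z = -f y x z) (h₂ : ∀ x y z, f x y z = -f x z y) (v : Fin 5 → V6) :
    wedge23 g f v =
      g (v 0) (v 1) * f (v 2) (v 3) (v 4) - g (v 0) (v 2) * f (v 1) (v 3) (v 4)
      + g (v 0) (v 3) * f (v 1) (v 2) (v 4) - g (v 0) (v 4) * f (v 1) (v 2) (v 3)
      + g (v 1) (v 2) * f (v 0) (v 3) (v 4) - g (v 1) (v 3) * f (v 0) (v 2) (v 4)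
      + g (v 1) (v 4) * f (v 0) (v 2) (v 3) + g (v 2) (v 3) * f (v 0) (v 1) (v 4)
      - g (v 2) (v 4) * f (v 0) (v 1) (v 3) + g (v 3) (v 4) * f (v 0) (v 1) (v 2) := by
  have key : wedge23 g f v = 1 / 12 * signedSum ![(0 : Fin 5), 1, 2, 3, 4]
      (fun w => g (v (w 0)) (v (w 1)) * f (v (w 2)) (v (w 3)) (v (w 4))) := by
    have h : ![(0 : Fin 5), 1, 2, 3, 4] = id := by ext k; fin_cases k <;> rfl
    simp [wedge23, signedSum, h]
  have hg' (i j) (_ : j < i) : g (v i) (v j) = -g (v j) (v i) := hg _ _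
  have h₁' (i j k) (_ : j < i) : f (v i) (v j) (v k) = -f (v j) (v i) (v k) := h₁ _ _ _
  have h₂' (i j k) (_ : k < j) : f (v i) (v j) (v k) = -f (v i) (v k) (v j) := h₂ _ _ _
  rw [key]
  simp [signedSum_five, signedSum_four, signedSum_three, hg', h₁', h₂']
  ring

/-- The matrix of `K_φ`, in terms of the coefficients `c i j k = φ(e_i, e_j, e_k)`:
`hitchinCoeff c j i` is the `i`-th coordinate of `K_φ e_j`. -/
def hitchinCoeff (c : Fin 6 → Fin 6 → Fin 6 → ℝ) (j i : Fin 6) : ℝ :=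
  let g := fun p q : Fin 5 => c j (i.succAbove p) (i.succAbove q)
  let f := fun p q r : Fin 5 => c (i.succAbove p) (i.succAbove q) (i.succAbove r)
  (-1) ^ (i : ℕ) *
    -(g 0 1 * f 2 3 4 - g 0 2 * f 1 3 4 + g 0 3 * f 1 2 4 - g 0 4 * f 1 2 3
      + g 1 2 * f 0 3 4 - g 1 3 * f 0 2 4 + g 1 4 * f 0 2 3
      + g 2 3 * f 0 1 4 - g 2 4 * f 0 1 3 + g 3 4 * f 0 1 2)

theorem Fin.succAbove_six (i : Fin 6) : i.succAbove = ![![1, 0, 0, 0, 0, 0] i, ![2, 2, 1, 1, 1, 1] i,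
    ![3, 3, 3, 2, 2, 2] i, ![4, 4, 4, 4, 3, 3] i, ![5, 5, 5, 5, 5, 4] i] := by
  ext k
  fin_cases i <;> fin_cases k <;> rfl

section Coefficients

variable {c : Fin 6 → Fin 6 → Fin 6 → ℝ}

set_option maxHeartbeats 4000000 in
theorem hitchinCoeff_symm
    (h₁ : ∀ i j k, c i j k = -c j i k) (h₂ : ∀ i j k, c i j k = -c i k j) (i j k : Fin 6) :
    ∑ l, hitchinCoeff c i l * c l j k = ∑ l, hitchinCoeff c j l * c i l k := by
  have h₁' (i j k) (_ : j < i) : c i j k = -c j i k := h₁ i j k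
  have h₂' (i j k) (_ : k < j) : c i j k = -c i k j := h₂ i j k
  have h₃ (i k) : c i i k = 0 := by linarith [h₁ i i k]
  have h₄ (i k) : c i k k = 0 := by linarith [h₂ i k k]
  obtain ⟨M, hM⟩ : ∃ M, hitchinCoeff c = M := ⟨_, rfl⟩
  rw [hM]
  replace hM : ∀ i j, M i j = hitchinCoeff c i j := fun i j => by rw [hM]
  simp [Fin.forall_fin_succ, hitchinCoeff, Fin.succAbove_six, h₁', h₂', h₃, h₄] at hM
  simp only [Fin.sum_univ_six]
  fin_cases i <;> fin_cases j <;> fin_cases k <;> simp [h₁', h₂', h₃, h₄] <;>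
    simp only [hM] <;> ring

set_option maxHeartbeats 4000000 in
theorem hitchinCoeff_sq
    (h₁ : ∀ i j k, c i j k = -c j i k) (h₂ : ∀ i j k, c i j k = -c i k j) (i j : Fin 6) :
    ∑ l, hitchinCoeff c i l * hitchinCoeff c l j =
      if i = j then 1 / 6 * ∑ m, ∑ l, hitchinCoeff c m l * hitchinCoeff c l m else 0 := by
  have h₁' (i j k) (_ : j < i) : c i j k = -c j i k := h₁ i j k
  have h₂' (i j k) (_ : k < j) : c i j k = -c i k j := h₂ i j k
  have h₃ (i k) : c i i k = 0 := by linarith [h₁ i i k]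
  have h₄ (i k) : c i k k = 0 := by linarith [h₂ i k k]
  obtain ⟨M, hM⟩ : ∃ M, hitchinCoeff c = M := ⟨_, rfl⟩
  rw [hM]
  replace hM : ∀ i j, M i j = hitchinCoeff c i j := fun i j => by rw [hM]
  simp [Fin.forall_fin_succ, hitchinCoeff, Fin.succAbove_six, h₁', h₂', h₃, h₄] at hM
  simp only [Fin.sum_univ_six]
  fin_cases i <;> fin_cases j <;> simp <;> simp only [hM] <;> ring

end Coefficients

theorem sum_smul_e6 (x : V6) : ∑ i, x i • e6 i = x := by
  ext j
  simp [e6]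

section ThreeForm

variable (φ : AlternatingMap ℝ V6 ℝ (Fin 3))

theorem ap3_swap_left (x y z : V6) : ap3 φ x y z = -ap3 φ y x z := by
  rw [ap3, ap3, ← φ.map_swap ![y, x, z] (i := 0) (j := 1) (by decide)]
  congr 1
  ext i : 1
  fin_cases i <;> rfl

theorem ap3_swap_right (x y z : V6) : ap3 φ x y z = -ap3 φ x z y := by
  rw [ap3, ap3, ← φ.map_swap ![x, z, y] (i := 1) (j := 2) (by decide)]
  congr 1
  ext i : 1
  fin_cases i <;> rfl

theorem ap3_sum_smul_left (a : Fin 6 → ℝ) (v : Fin 6 → V6) (y z : V6) :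
    ap3 φ (∑ i, a i • v i) y z = ∑ i, a i * ap3 φ (v i) y z := by
  let L : V6 →ₗ[ℝ] ℝ :=
    { toFun := fun x => ap3 φ x y z
      map_add' := fun x x' => congrArg (fun f => f ![y, z]) (φ.curryLeft.map_add x x')
      map_smul' := fun r x => congrArg (fun f => f ![y, z]) (φ.curryLeft.map_smul r x) }
  change L (∑ i, a i • v i) = ∑ i, a i * L (v i)
  simp

theorem ap3_sum_smul_mid (a : Fin 6 → ℝ) (v : Fin 6 → V6) (x z : V6) :
    ap3 φ x (∑ i, a i • v i) z = ∑ i, a i * ap3 φ x (v i) z := by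
  simp [ap3_swap_left φ x, ap3_sum_smul_left]

theorem ap3_sum_smul_right (a : Fin 6 → ℝ) (v : Fin 6 → V6) (x y : V6) :
    ap3 φ x y (∑ i, a i • v i) = ∑ i, a i * ap3 φ x y (v i) := by
  simp [ap3_swap_right φ x y, ap3_sum_smul_mid]

theorem ap3_smul_left (a : ℝ) (x y z : V6) : ap3 φ (a • x) y z = a * ap3 φ x y z :=
  congrArg (fun f => f ![y, z]) (φ.curryLeft.map_smul a x)

theorem ap3_smul_mid (a : ℝ) (x y z : V6) : ap3 φ x (a • y) z = a * ap3 φ x y z := by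
  rw [ap3_swap_left, ap3_smul_left, ap3_swap_left φ x]
  ring

/-- The coefficients of a 3-form in the standard basis. -/
def coeff3 (i j k : Fin 6) : ℝ := ap3 φ (e6 i) (e6 j) (e6 k)

theorem Kmap_ap3_apply (x : V6) (i : Fin 6) :
    Kmap (ap3 φ) x i = ∑ j, x j * hitchinCoeff (coeff3 φ) j i := by
  have h (y z : V6) : ap3 φ x y z = ∑ j, x j * ap3 φ (e6 j) y z := by
    rw [← ap3_sum_smul_left, sum_smul_e6]
  rw [Kmap, wedge23_eq _ _ (ap3_swap_right φ x) (ap3_swap_left φ) (ap3_swap_right φ)]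
  simp only [h, hitchinCoeff, coeff3, Fin.sum_univ_six]
  ring

theorem Kmap_ap3_e6 (i : Fin 6) :
    Kmap (ap3 φ) (e6 i) = ∑ l, hitchinCoeff (coeff3 φ) i l • e6 l := by
  ext j
  simp [Kmap_ap3_apply, e6]

theorem Kmap_ap3_eq_sum (x : V6) : Kmap (ap3 φ) x = ∑ i, x i • Kmap (ap3 φ) (e6 i) := by
  ext j
  simp [Kmap_ap3_apply, e6]

theorem ap3_Kmap_left (x y z : V6) :
    ap3 φ (Kmap (ap3 φ) x) y z = ap3 φ x (Kmap (ap3 φ) y) z := by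
  have basis (i j k : Fin 6) : ap3 φ (Kmap (ap3 φ) (e6 i)) (e6 j) (e6 k) =
      ap3 φ (e6 i) (Kmap (ap3 φ) (e6 j)) (e6 k) := by
    rw [Kmap_ap3_e6, Kmap_ap3_e6, ap3_sum_smul_left, ap3_sum_smul_mid]
    exact hitchinCoeff_symm (c := coeff3 φ) (fun _ _ _ => ap3_swap_left φ _ _ _)
      (fun _ _ _ => ap3_swap_right φ _ _ _) i j k
  have left (x : V6) (j k : Fin 6) : ap3 φ (Kmap (ap3 φ) x) (e6 j) (e6 k) =
      ap3 φ x (Kmap (ap3 φ) (e6 j)) (e6 k) := by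
    rw [Kmap_ap3_eq_sum]
    conv_rhs => rw [← sum_smul_e6 x]
    simp only [ap3_sum_smul_left, basis]
  have mid (x y : V6) (k : Fin 6) : ap3 φ (Kmap (ap3 φ) x) y (e6 k) =
      ap3 φ x (Kmap (ap3 φ) y) (e6 k) := by
    rw [Kmap_ap3_eq_sum φ y]
    conv_lhs => rw [← sum_smul_e6 y]
    simp only [ap3_sum_smul_mid, left]
  rw [← sum_smul_e6 z]
  simp only [ap3_sum_smul_right, mid]

theorem Kmap_ap3_Kmap (x : V6) : Kmap (ap3 φ) (Kmap (ap3 φ) x) = lamH (ap3 φ) • x := by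
  have hsq := hitchinCoeff_sq (c := coeff3 φ) (fun _ _ _ => ap3_swap_left φ _ _ _)
    (fun _ _ _ => ap3_swap_right φ _ _ _)
  have hK (x : V6) (i : Fin 6) : Kmap (ap3 φ) (Kmap (ap3 φ) x) i =
      ∑ j, x j * ∑ l, hitchinCoeff (coeff3 φ) j l * hitchinCoeff (coeff3 φ) l i := by
    simp only [Kmap_ap3_apply, Finset.sum_mul, Finset.mul_sum, mul_assoc]
    exact Finset.sum_comm
  have hlam : lamH (ap3 φ) =
      1 / 6 * ∑ m, ∑ l, hitchinCoeff (coeff3 φ) m l * hitchinCoeff (coeff3 φ) l m := by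
    simp [lamH, hK, e6]
  simp only [← hlam] at hsq
  ext i
  simp only [hK, hsq, mul_ite, mul_zero, Finset.sum_ite_eq', Finset.mem_univ, if_true,
    Pi.smul_apply, smul_eq_mul, mul_comm]

end ThreeForm

/-- For a 3-form φ on ℝ⁶ with λ_φ < 0: moving `J_φ` across the arguments of φ,
`φ(J_φ x, y, z) = φ(x, J_φ y, z) = φ(x, y, J_φ z)`, `φ(J_φ x, J_φ y, z) = −φ(x, y, z)`, and
`φ̂(x,y,z) := φ(J_φ x, J_φ y, J_φ z) = −φ(J_φ x, y, z)`, i.e. `φ + i φ̂` is a (3,0)-form. -/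
theorem phi_is_real_part_of_30_form (φ : AlternatingMap ℝ V6 ℝ (Fin 3))
    (hlam : lamH (ap3 φ) < 0) :
    (∀ x y z : V6, φ ![Jmap (ap3 φ) x, y, z] = φ ![x, Jmap (ap3 φ) y, z]) ∧
    (∀ x y z : V6, φ ![x, Jmap (ap3 φ) y, z] = φ ![x, y, Jmap (ap3 φ) z]) ∧
    (∀ x y z : V6, φ ![Jmap (ap3 φ) x, Jmap (ap3 φ) y, z] = -φ ![x, y, z]) ∧
    (∀ x y z : V6,
      φ ![Jmap (ap3 φ) x, Jmap (ap3 φ) y, Jmap (ap3 φ) z] = -φ ![Jmap (ap3 φ) x, y, z]) := by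
  set J := Jmap (ap3 φ) with hJ
  have hsymm (x y z : V6) : ap3 φ (J x) y z = ap3 φ x (J y) z := by
    simp only [hJ, Jmap, ap3_smul_left, ap3_smul_mid, ap3_Kmap_left]
  have hmid (x y z : V6) : ap3 φ x (J y) z = ap3 φ x y (J z) := by
    rw [← hsymm, ap3_swap_right, hsymm, ← ap3_swap_right]
  have hsq (x y z : V6) : ap3 φ (J x) (J y) z = -ap3 φ x y z := by
    have hs : (√(-lamH (ap3 φ)))⁻¹ * (√(-lamH (ap3 φ)))⁻¹ * lamH (ap3 φ) = -1 := by
      rw [← mul_inv, Real.mul_self_sqrt (by linarith)]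
      field_simp [hlam.ne]
    simp only [hJ, Jmap, ap3_smul_left, ap3_smul_mid]
    rw [← ap3_Kmap_left, Kmap_ap3_Kmap, ap3_smul_left]
    linear_combination ap3 φ x y z * hs
  refine ⟨hsymm, hmid, hsq, fun x y z => ?_⟩
  change ap3 φ (J x) (J y) (J z) = -ap3 φ (J x) y z
  rw [hsq, ← hmid, ← hsymm]
end
end

section
/- Metric formula in Type IIA geometry (pointwise form): let φ be a 3-form on ℝ⁶ with ω ∧ φ = 0, λ_φ < 0, and ω(x, J_φ x) > 0 for all x ≠ 0. Then for all x, y ∈ ℝ⁶: ι_x φ ∧ ι_y φ ∧ ω = √(−λ_φ)·ω(x, J_φ y)·vol. In particular the bilinear form (x, y) ↦ (ι_x φ ∧ ι_y φ ∧ ω)/vol is symmetric and positive definite. -/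
noncomputable section

/-- The volume form `vol = e¹∧e²∧e³∧e⁴∧e⁵∧e⁶ = ω³/3!`. -/
def vol6 (v : Fin 6 → V6) : ℝ := (Matrix.of fun i j => v i j).det

/-- Wedge product of three 2-forms (standard convention `1/(2!·2!·2!)`). -/
def wedge222 (a b c : V6 → V6 → ℝ) (v : Fin 6 → V6) : ℝ :=
  (1 / 8 : ℝ) * ∑ σ : Equiv.Perm (Fin 6),
    ((Equiv.Perm.sign σ : ℤ) : ℝ) *
      (a (v (σ 0)) (v (σ 1)) * b (v (σ 2)) (v (σ 3)) * c (v (σ 4)) (v (σ 5)))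

/-- The signed sum of `G (v ∘ σ)` over all permutations `σ`. -/
def altSum {α : Type*} {n : ℕ} (G : (Fin n → α) → ℝ) (v : Fin n → α) : ℝ :=
  ∑ σ : Equiv.Perm (Fin n), ((Equiv.Perm.sign σ : ℤ) : ℝ) * G (v ∘ σ)

/-- Laplace expansion of a signed sum along its first argument. -/
theorem altSum_succ {α : Type*} {n : ℕ} (G : (Fin (n + 1) → α) → ℝ) (v : Fin (n + 1) → α) :
    altSum G v = ∑ p : Fin (n + 1), (-1 : ℝ) ^ (p : ℕ) *
      altSum (fun w => G (Matrix.vecCons (v p) w)) (v ∘ p.succAbove) := by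
  unfold altSum
  rw [Finset.univ_perm_fin_succ, Finset.sum_map, ← Finset.univ_product_univ, Finset.sum_product]
  refine Finset.sum_congr rfl fun p _ => ?_
  rw [Finset.mul_sum]
  refine Fin.cases ?_ (fun i => ?_) p
  · refine Finset.sum_congr rfl fun τ _ => ?_
    have h : v ∘ Equiv.Perm.decomposeFin.symm (0, τ) =
        Matrix.vecCons (v 0) ((v ∘ Fin.succAbove 0) ∘ τ) := by
      ext j
      refine Fin.cases ?_ (fun j => ?_) j <;> simp
    simp [h]
  · refine (Finset.sum_congr rfl fun τ _ => ?_).trans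
      (Equiv.sum_comp (Equiv.mulLeft i.cycleRange) fun τ => _)
    have h : v ∘ Equiv.Perm.decomposeFin.symm (i.succ, τ) =
        Matrix.vecCons (v i.succ) ((v ∘ i.succ.succAbove) ∘ (i.cycleRange * τ)) := by
      ext j
      refine Fin.cases ?_ (fun j => ?_) j <;> simp
    have hs : ((-1 : ℝ) ^ (i : ℕ)) * (-1) ^ (i : ℕ) = 1 := by
      rw [← mul_pow]; simp
    rw [Equiv.toEmbedding_apply, h, Equiv.Perm.decomposeFin.symm_sign,
      if_neg (Fin.succ_ne_zero i), Equiv.coe_mulLeft, Equiv.Perm.sign_mul, Fin.sign_cycleRange,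
      Fin.val_succ, pow_succ]
    beta_reduce
    rw [Equiv.Perm.coe_mul]
    push_cast
    linear_combination (G (Matrix.vecCons (v i.succ) ((v ∘ i.succ.succAbove) ∘
      i.cycleRange ∘ τ)) * ((Equiv.Perm.sign τ : ℤ) : ℝ)) * hs

theorem altSum_zero {α : Type*} (G : (Fin 0 → α) → ℝ) (v : Fin 0 → α) :
    altSum G v = G v := by
  simp [altSum, Subsingleton.elim (v ∘ _) v]

theorem altSum_three_of_alternating {α : Type*} (b : α → α → α → ℝ)
    (hb : ∀ i j k, b j i k = - b i j k)
    (hb' : ∀ i j k, b i k j = - b i j k) (v : Fin 3 → α) :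
    altSum (fun w => b (w 0) (w 1) (w 2)) v = 6 * b (v 0) (v 1) (v 2) := by
  simp [altSum_succ, altSum_zero, Fin.sum_univ_succ, Fin.succAbove]
  linarith [hb (v 0) (v 1) (v 2), hb' (v 0) (v 1) (v 2), hb (v 0) (v 2) (v 1),
    hb' (v 1) (v 0) (v 2), hb' (v 2) (v 0) (v 1), hb (v 1) (v 2) (v 0)]

set_option maxRecDepth 4000 in
theorem altSum_four_mul_of_antisymm {α : Type*} (b c : α → α → ℝ)
    (hb : ∀ i j, b j i = - b i j)
    (hc : ∀ i j, c j i = - c i j) (v : Fin 4 → α) :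
    altSum (fun w => b (w 0) (w 1) * c (w 2) (w 3)) v = 4 * (b (v 0) (v 1) * c (v 2) (v 3)
      - b (v 0) (v 2) * c (v 1) (v 3) + b (v 0) (v 3) * c (v 1) (v 2)
      + b (v 1) (v 2) * c (v 0) (v 3) - b (v 1) (v 3) * c (v 0) (v 2) +
      b (v 2) (v 3) * c (v 0) (v 1)) := by
  simp [altSum_succ, altSum_zero, Fin.sum_univ_succ, Fin.succAbove]
  simp only [hb (v 0) (v 1), hb (v 0) (v 2), hb (v 0) (v 3), hb (v 1) (v 2), hb (v 1) (v 3),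
    hb (v 2) (v 3),
    hc (v 0) (v 1), hc (v 0) (v 2), hc (v 0) (v 3), hc (v 1) (v 2), hc (v 1) (v 3), hc (v 2) (v 3)]
  ring

theorem wedge23_eq_s3 (a : V6 → V6 → ℝ) (b : V6 → V6 → V6 → ℝ) (ha : ∀ i j, a j i = - a i j)
    (hb : ∀ i j k, b j i k = - b i j k)
    (hb' : ∀ i j k, b i k j = - b i j k) (v : Fin 5 → V6) :
    wedge23 a b v = a (v 0) (v 1) * b (v 2) (v 3) (v 4) - a (v 0) (v 2) * b (v 1) (v 3) (v 4)
      + a (v 0) (v 3) * b (v 1) (v 2) (v 4) - a (v 0) (v 4) * b (v 1) (v 2) (v 3)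
      + a (v 1) (v 2) * b (v 0) (v 3) (v 4) - a (v 1) (v 3) * b (v 0) (v 2) (v 4)
      + a (v 1) (v 4) * b (v 0) (v 2) (v 3) + a (v 2) (v 3) * b (v 0) (v 1) (v 4)
      - a (v 2) (v 4) * b (v 0) (v 1) (v 3) + a (v 3) (v 4) * b (v 0) (v 1) (v 2) := by
  have h (x y : V6) (w : Fin 3 → V6) :
      altSum (fun w => a x y * b (w 0) (w 1) (w 2)) w = a x y * (6 * b (w 0) (w 1) (w 2)) := by
    rw [← altSum_three_of_alternating b hb hb']
    simp only [altSum, Finset.mul_sum]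
    exact Finset.sum_congr rfl fun _ _ => by ring
  change (1 / 12 : ℝ) * altSum (fun w => a (w 0) (w 1) * b (w 2) (w 3) (w 4)) v = _
  rw [altSum_succ]
  simp only [altSum_succ (n := 3), Matrix.cons_val, h]
  simp [Fin.sum_univ_succ, Fin.succAbove]
  simp only [ha (v 0) (v 1), ha (v 0) (v 2), ha (v 0) (v 3), ha (v 0) (v 4), ha (v 1) (v 2),
    ha (v 1) (v 3), ha (v 1) (v 4), ha (v 2) (v 3), ha (v 2) (v 4), ha (v 3) (v 4)]
  ring

theorem ω6_e6 (i j : Fin 6) : ω6 (e6 i) (e6 j) =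
    !![0, 1, 0, 0, 0, 0; -1, 0, 0, 0, 0, 0; 0, 0, 0, 1, 0, 0; 0, 0, -1, 0, 0, 0;
      0, 0, 0, 0, 0, 1; 0, 0, 0, 0, -1, (0 : ℝ)] i j := by
  fin_cases i <;> fin_cases j <;> simp [ω6, e6]

theorem ω6_swap (x y : V6) : ω6 y x = - ω6 x y := by
  unfold ω6; ring

set_option maxRecDepth 4000 in
theorem wedge222_ω6_e6 (a b : V6 → V6 → ℝ) (ha : ∀ i j, a j i = - a i j)
    (hb : ∀ i j, b j i = - b i j) :
    wedge222 a b ω6 e6 =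
      (a (e6 0) (e6 1) * b (e6 2) (e6 3) - a (e6 0) (e6 2) * b (e6 1) (e6 3) +
        a (e6 0) (e6 3) * b (e6 1) (e6 2) + a (e6 1) (e6 2) * b (e6 0) (e6 3)
        - a (e6 1) (e6 3) * b (e6 0) (e6 2) + a (e6 2) (e6 3) * b (e6 0) (e6 1))
      + (a (e6 0) (e6 1) * b (e6 4) (e6 5) - a (e6 0) (e6 4) * b (e6 1) (e6 5) +
        a (e6 0) (e6 5) * b (e6 1) (e6 4) + a (e6 1) (e6 4) * b (e6 0) (e6 5)
        - a (e6 1) (e6 5) * b (e6 0) (e6 4) + a (e6 4) (e6 5) * b (e6 0) (e6 1))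
      + (a (e6 2) (e6 3) * b (e6 4) (e6 5) - a (e6 2) (e6 4) * b (e6 3) (e6 5) +
        a (e6 2) (e6 5) * b (e6 3) (e6 4) + a (e6 3) (e6 4) * b (e6 2) (e6 5)
        - a (e6 3) (e6 5) * b (e6 2) (e6 4) + a (e6 4) (e6 5) * b (e6 2) (e6 3)) := by
  have h (x y : V6) (w : Fin 4 → V6) :
      altSum (fun w => a x y * b (w 0) (w 1) * ω6 (w 2) (w 3)) w =
        a x y * altSum (fun w => b (w 0) (w 1) * ω6 (w 2) (w 3)) w := by
    simp only [altSum, Finset.mul_sum]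
    exact Finset.sum_congr rfl fun _ _ => by ring
  change (1 / 8 : ℝ) * altSum (fun w => a (w 0) (w 1) * b (w 2) (w 3) * ω6 (w 4) (w 5)) e6 = _
  rw [altSum_succ]
  simp only [altSum_succ (n := 4), Matrix.cons_val, h, altSum_four_mul_of_antisymm b ω6 hb ω6_swap]
  simp [Fin.sum_univ_succ, Fin.succAbove, ω6_e6]
  simp only [ha (e6 0) (e6 1), ha (e6 0) (e6 2), ha (e6 0) (e6 3), ha (e6 0) (e6 4),
    ha (e6 0) (e6 5), ha (e6 1) (e6 2), ha (e6 1) (e6 3), ha (e6 1) (e6 4), ha (e6 1) (e6 5),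
    ha (e6 2) (e6 3), ha (e6 2) (e6 4), ha (e6 2) (e6 5), ha (e6 3) (e6 4), ha (e6 3) (e6 5),
    ha (e6 4) (e6 5)]
  ring

/-- The coefficients of `ι_y φ` in the standard basis. -/
def contractCoeff (φ : AlternatingMap ℝ V6 ℝ (Fin 3)) (y : V6) (i j : Fin 6) : ℝ :=
  φ ![y, e6 i, e6 j]

/-- The coefficients of a 3-form in the standard basis. -/
def coeff (φ : AlternatingMap ℝ V6 ℝ (Fin 3)) (i j k : Fin 6) : ℝ := φ ![e6 i, e6 j, e6 k]

theorem apply_swap (φ : AlternatingMap ℝ V6 ℝ (Fin 3)) (x y z : V6) :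
    φ ![y, x, z] = - φ ![x, y, z] := by
  rw [← φ.map_swap ![x, y, z] (show (0 : Fin 3) ≠ 1 by decide)]
  congr 1; ext i; fin_cases i <;> rfl

theorem apply_swap' (φ : AlternatingMap ℝ V6 ℝ (Fin 3)) (x y z : V6) :
    φ ![x, z, y] = - φ ![x, y, z] := by
  rw [← φ.map_swap ![x, y, z] (show (1 : Fin 3) ≠ 2 by decide)]
  congr 1; ext i; fin_cases i <;> rfl

theorem apply_self (φ : AlternatingMap ℝ V6 ℝ (Fin 3)) (x y : V6) : φ ![x, x, y] = 0 :=
  φ.map_eq_zero_of_eq _ (i := 0) (j := 1) rfl (by decide)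

theorem apply_self' (φ : AlternatingMap ℝ V6 ℝ (Fin 3)) (x y : V6) : φ ![x, y, y] = 0 :=
  φ.map_eq_zero_of_eq _ (i := 1) (j := 2) rfl (by decide)

theorem apply_rotate (φ : AlternatingMap ℝ V6 ℝ (Fin 3)) (x y z : V6) :
    φ ![x, y, z] = φ ![z, x, y] := by
  rw [apply_swap' φ x z y, apply_swap φ z x y, neg_neg]

/-- A 3-form as a linear function of its first argument. -/
def ap3Lin (φ : AlternatingMap ℝ V6 ℝ (Fin 3)) (y z : V6) : V6 →ₗ[ℝ] ℝ where
  toFun x := φ ![x, y, z]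
  map_add' := φ.map_vecCons_add ![y, z]
  map_smul' := φ.map_vecCons_smul ![y, z]

theorem apply_e6_e6_eq_sum (φ : AlternatingMap ℝ V6 ℝ (Fin 3)) (x : V6) (i j : Fin 6) :
    φ ![x, e6 i, e6 j] = ∑ k, x k * coeff φ k i j := by
  have h := (ap3Lin φ (e6 i) (e6 j)).pi_apply_eq_sum_univ x
  have he (k : Fin 6) : (fun j => if k = j then (1 : ℝ) else 0) = e6 k := by
    ext j; simp [e6, eq_comm]
  simp only [he] at h
  exact h

/-- Contracting `ω ∧ φ = 0` with `x` turns `ι_x φ ∧ ι_y φ ∧ ω` into `-ι_x ω ∧ φ ∧ ι_y φ`, which is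
`ω(x, K_φ y) vol`. -/
theorem wedge222_contract_e6 (φ : AlternatingMap ℝ V6 ℝ (Fin 3))
    (hprim : ∀ v : Fin 5 → V6, wedge23 ω6 (ap3 φ) v = 0) (x y : V6) :
    wedge222 (fun p q => φ ![x, p, q]) (fun p q => φ ![y, p, q]) ω6 e6
        = ω6 x (Kmap (ap3 φ) y) := by
  have hF1 {i j k : Fin 6} (h : j < i) : coeff φ i j k = - coeff φ j i k := apply_swap ..
  have hF2 {i j k : Fin 6} (h : k < j) : coeff φ i j k = - coeff φ i k j := apply_swap' ..
  have hF3 (i k : Fin 6) : coeff φ i i k = 0 := apply_self ..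
  have hF4 (i k : Fin 6) : coeff φ i k k = 0 := apply_self' ..
  have hP (m : Fin 6) := hprim (fun j => e6 (m.succAbove j))
  simp only [wedge23_eq_s3 ω6 (ap3 φ) ω6_swap (apply_swap φ) (apply_swap' φ), ω6_e6] at hP
  rw [wedge222_ω6_e6 _ _ (apply_swap' φ x) (apply_swap' φ y)]
  simp only [ω6, Kmap]
  simp only [wedge23_eq_s3 (fun p q => ap3 φ y p q) (ap3 φ) (apply_swap' φ y) (apply_swap φ)
    (apply_swap' φ)]
  have hB (i j : Fin 6) : φ ![y, e6 i, e6 j] = contractCoeff φ y i j := rfl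
  have hF (i j k : Fin 6) : φ ![e6 i, e6 j, e6 k] = coeff φ i j k := rfl
  simp only [ap3, hB, hF, apply_e6_e6_eq_sum φ x] at hP ⊢
  clear hB hF
  have h0 := hP 0
  have h1 := hP 1
  have h2 := hP 2
  have h3 := hP 3
  have h4 := hP 4
  have h5 := hP 5
  clear hP
  simp [Fin.succAbove] at h0 h1 h2 h3 h4 h5
  simp [Fin.succAbove, Fin.sum_univ_succ, hF1, hF2, hF3, hF4]
  linear_combination (x 1 * contractCoeff φ y 0 1 + x 2 * contractCoeff φ y 0 2 +
    x 3 * contractCoeff φ y 0 3 + x 4 * contractCoeff φ y 0 4 + x 5 * contractCoeff φ y 0 5) * h0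
    - (- x 0 * contractCoeff φ y 0 1 + x 2 * contractCoeff φ y 1 2 +
    x 3 * contractCoeff φ y 1 3 + x 4 * contractCoeff φ y 1 4 + x 5 * contractCoeff φ y 1 5) * h1
    + (- x 0 * contractCoeff φ y 0 2 - x 1 * contractCoeff φ y 1 2 +
    x 3 * contractCoeff φ y 2 3 + x 4 * contractCoeff φ y 2 4 + x 5 * contractCoeff φ y 2 5) * h2
    - (- x 0 * contractCoeff φ y 0 3 - x 1 * contractCoeff φ y 1 3
    - x 2 * contractCoeff φ y 2 3 + x 4 * contractCoeff φ y 3 4 + x 5 * contractCoeff φ y 3 5) * h3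
    + (- x 0 * contractCoeff φ y 0 4 - x 1 * contractCoeff φ y 1 4
    - x 2 * contractCoeff φ y 2 4 - x 3 * contractCoeff φ y 3 4 + x 5 * contractCoeff φ y 4 5) * h4
    - (- x 0 * contractCoeff φ y 0 5 - x 1 * contractCoeff φ y 1 5
    - x 2 * contractCoeff φ y 2 5 - x 3 * contractCoeff φ y 3 5 - x 4 * contractCoeff φ y 4 5) * h5

/-- A 6-form on `ℝ⁶` is determined by its value on the standard basis. -/
theorem wedge222_eq_mul_vol6 (A C D : V6 →ₗ[ℝ] V6 →ₗ[ℝ] ℝ) (v : Fin 6 → V6) :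
    wedge222 (fun p q => A p q) (fun p q => C p q) (fun p q => D p q) v =
      wedge222 (fun p q => A p q) (fun p q => C p q) (fun p q => D p q) e6 * vol6 v := by
  let M : MultilinearMap ℝ (fun _ : Fin 6 => V6) ℝ :=
    { toFun := fun w => A (w 0) (w 1) * C (w 2) (w 3) * D (w 4) (w 5)
      map_update_add' := by
        intro inst w i x y
        obtain rfl := Subsingleton.elim inst (instDecidableEqFin 6)
        fin_cases i <;> simp [Function.update] <;> ring
      map_update_smul' := by
        intro inst w i c x
        obtain rfl := Subsingleton.elim inst (instDecidableEqFin 6)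
        fin_cases i <;> simp [Function.update] <;> ring }
  have h (w : Fin 6 → V6) : wedge222 (fun p q => A p q) (fun p q => C p q) (fun p q => D p q) w =
      (1 / 8 : ℝ) * MultilinearMap.alternatization M w := by
    rw [MultilinearMap.alternatization_apply]
    simp [wedge222, M, Units.smul_def]
  have he : (Pi.basisFun ℝ (Fin 6) : Fin 6 → V6) = e6 := by
    ext i j; simp [e6, Pi.single_apply]
  have hd : (Pi.basisFun ℝ (Fin 6)).det v = vol6 v := by
    rw [Module.Basis.det_apply, vol6, ← Matrix.det_transpose]
    congr 1
  rw [h, h,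
    AlternatingMap.eq_smul_basis_det (Pi.basisFun ℝ (Fin 6)) (MultilinearMap.alternatization M),
    AlternatingMap.smul_apply, AlternatingMap.smul_apply, hd,
    ← he, Module.Basis.det_self, smul_eq_mul, smul_eq_mul, mul_one, mul_assoc]

/-- The contraction `ι_x φ` as a bilinear map. -/
def contract (φ : AlternatingMap ℝ V6 ℝ (Fin 3)) (x : V6) : V6 →ₗ[ℝ] V6 →ₗ[ℝ] ℝ :=
  LinearMap.mk₂ ℝ (fun p q => φ ![x, p, q])
    (fun p p' q => by
      simp only [apply_rotate φ x _ q, apply_rotate φ q x]; exact map_add (ap3Lin φ q x) p p')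
    (fun c p q => by
      simp only [apply_rotate φ x _ q, apply_rotate φ q x]; exact map_smul (ap3Lin φ q x) c p)
    (fun p q q' => by simp only [apply_rotate φ x p]; exact map_add (ap3Lin φ x p) q q')
    (fun c p q => by simp only [apply_rotate φ x p]; exact map_smul (ap3Lin φ x p) c q)

/-- The symplectic form as a bilinear map. -/
def ω6Lin : V6 →ₗ[ℝ] V6 →ₗ[ℝ] ℝ :=
  LinearMap.mk₂ ℝ ω6 (fun _ _ _ => by simp [ω6]; ring) (fun _ _ _ => by simp [ω6]; ring)
    (fun _ _ _ => by simp [ω6]; ring) (fun _ _ _ => by simp [ω6]; ring)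

/-- Metric formula in Type IIA geometry (pointwise form):
`ι_x φ ∧ ι_y φ ∧ ω = √(−λ_φ)·ω(x, J_φ y)·vol`; in particular the bilinear form
`(x, y) ↦ (ι_x φ ∧ ι_y φ ∧ ω)/vol` (here evaluated on the standard basis, since
`vol(e₁,…,e₆) = 1`) is symmetric and positive definite. -/
theorem metric_formula (φ : AlternatingMap ℝ V6 ℝ (Fin 3))
    (hprim : ∀ v : Fin 5 → V6, wedge23 ω6 (ap3 φ) v = 0)
    (hlam : lamH (ap3 φ) < 0)
    (hpos : ∀ x : V6, x ≠ 0 → 0 < ω6 x (Jmap (ap3 φ) x)) :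
    (∀ x y : V6, ∀ v : Fin 6 → V6,
      wedge222 (fun p q => φ ![x, p, q]) (fun p q => φ ![y, p, q]) ω6 v
        = Real.sqrt (-(lamH (ap3 φ))) * ω6 x (Jmap (ap3 φ) y) * vol6 v) ∧
    (∀ x y : V6,
      wedge222 (fun p q => φ ![x, p, q]) (fun p q => φ ![y, p, q]) ω6 e6
        = wedge222 (fun p q => φ ![y, p, q]) (fun p q => φ ![x, p, q]) ω6 e6) ∧
    (∀ x : V6, x ≠ 0 →
      0 < wedge222 (fun p q => φ ![x, p, q]) (fun p q => φ ![x, p, q]) ω6 e6) := by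
  have hs : 0 < Real.sqrt (-(lamH (ap3 φ))) := Real.sqrt_pos.2 (neg_pos.2 hlam)
  have hJ (x y : V6) : Real.sqrt (-(lamH (ap3 φ))) * ω6 x (Jmap (ap3 φ) y) =
      ω6 x (Kmap (ap3 φ) y) := by
    simp only [Jmap, ω6, Pi.smul_apply, smul_eq_mul]
    field_simp
  refine ⟨fun x y v => ?_, fun x y => ?_, fun x hx => ?_⟩
  · have h := wedge222_eq_mul_vol6 (contract φ x) (contract φ y) ω6Lin v
    rw [hJ, ← wedge222_contract_e6 φ hprim]
    exact h
  · rw [wedge222_ω6_e6 _ _ (apply_swap' φ x) (apply_swap' φ y),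
      wedge222_ω6_e6 _ _ (apply_swap' φ y) (apply_swap' φ x)]
    ring
  · rw [wedge222_contract_e6 φ hprim, ← hJ]
    exact mul_pos hs (hpos x hx)
end
end
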